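/- arXiv:math/0002053 — 4 statements merged into one kernel-verified Lean document; each statement's English description precedes it below -/
import Mathlib

section
/- (Lemma 2.12(iii).) Let A and B be real l×k matrices with Matrix.rank A < Matrix.rank B. Then the set Λ = {λ : ℝ | Matrix.rank B ≤ Matrix.rank (A + λ • B)} is an open and dense subset of ℝ. -/
/-- Every matrix over a field can be compressed to an identity matrix of size its rank. -/
theorem Matrix.exists_mul_mul_eq_one_rank {m n K : Type*} [Fintype m] [Fintype n] [DecidableEq m]
    [DecidableEq n] [Field K] (M : Matrix m n K) :
    ∃ (C : Matrix (Fin M.rank) m K) (D : Matrix n (Fin M.rank) K), C * M * D = 1 := by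
  let f := Matrix.toLin' M
  have hr : Module.finrank K (LinearMap.range f) = M.rank := rfl
  let e : (Fin M.rank → K) ≃ₗ[K] LinearMap.range f :=
    (Module.finBasisOfFinrankEq K (LinearMap.range f) hr).equivFun.symm
  obtain ⟨s, hs⟩ := f.rangeRestrict.exists_rightInverse_of_surjective f.range_rangeRestrict
  obtain ⟨p, hp⟩ := (LinearMap.range f).subtype.exists_leftInverse_of_injective
    (LinearMap.range f).ker_subtype
  refine ⟨LinearMap.toMatrix' (e.symm.toLinearMap ∘ₗ p),
    LinearMap.toMatrix' (s ∘ₗ e.toLinearMap), ?_⟩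
  have hM : M = LinearMap.toMatrix' f := (LinearMap.toMatrix'_toLin' M).symm
  conv_lhs => enter [1, 2]; rw [hM]
  rw [← LinearMap.toMatrix'_comp, ← LinearMap.toMatrix'_comp, ← LinearMap.toMatrix'_id]
  congr 1
  refine LinearMap.ext fun x => ?_
  have h₁ : f (s (e x)) = (e x : m → K) := congrArg Subtype.val (LinearMap.congr_fun hs (e x))
  have h₂ : p (e x : m → K) = e x := LinearMap.congr_fun hp (e x)
  simp [h₁, h₂]

/-- If a compression of `M` to a square matrix of size `r` is nonsingular, then `M` has rank at
least `r`. -/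
theorem Matrix.le_rank_of_det_mul_mul_ne_zero {m n K : Type*} [Fintype m] [Fintype n] [Field K]
    {r : ℕ} {M : Matrix m n K} {C : Matrix (Fin r) m K} {D : Matrix n (Fin r) K}
    (h : (C * M * D).det ≠ 0) : r ≤ M.rank := by
  have hr : (C * M * D).rank = r := by
    rw [Matrix.rank_of_isUnit _ ((Matrix.isUnit_iff_isUnit_det _).2 h.isUnit), Fintype.card_fin]
  calc r = (C * M * D).rank := hr.symm
    _ ≤ (C * M).rank := Matrix.rank_mul_le_left _ _
    _ ≤ M.rank := Matrix.rank_mul_le_right _ _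

/-- The matrix rank is lower semicontinuous. -/
theorem Matrix.isOpen_setOfPred_le_rank {m n K : Type*} [Fintype m] [Fintype n] [Field K]
    [TopologicalSpace K] [IsTopologicalRing K] [T1Space K] (r : ℕ) :
    IsOpen {M : Matrix m n K | r ≤ M.rank} := by
  classical
  refine isOpen_iff_mem_nhds.2 fun M hM => ?_
  obtain ⟨C, D, hCD⟩ := M.exists_mul_mul_eq_one_rank
  have hc : Continuous fun N : Matrix m n K => (C * N * D).det := by fun_prop
  have hM0 : (C * M * D).det ≠ 0 := by simp [hCD]
  filter_upwards [hc.continuousAt.eventually_ne hM0] with N hN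
  exact le_trans hM (Matrix.le_rank_of_det_mul_mul_ne_zero hN)

/-- The matrices `A + c • B` have rank at least that of `B` for all but finitely many `c`. -/
theorem Matrix.finite_setOfPred_rank_add_smul_lt {m n K : Type*} [Fintype m] [Fintype n] [Field K]
    (A B : Matrix m n K) : {c : K | (A + c • B).rank < B.rank}.Finite := by
  classical
  obtain ⟨C, D, hCD⟩ := B.exists_mul_mul_eq_one_rank
  have hp := (Matrix.charpoly_monic (-(C * A * D))).ne_zero
  refine (Polynomial.finite_setOfPred_isRoot hp).subset fun c hc => ?_
  by_contra hroot
  refine (not_le_of_gt hc) (Matrix.le_rank_of_det_mul_mul_ne_zero (C := C) (D := D) ?_)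
  have he : C * (A + c • B) * D = Matrix.scalar _ c - -(C * A * D) := by
    rw [Matrix.mul_add, Matrix.add_mul, Matrix.mul_smul, Matrix.smul_mul, hCD,
      Matrix.smul_one_eq_diagonal, sub_neg_eq_add, add_comm, Matrix.scalar_apply]
  rw [he, ← Matrix.eval_charpoly]
  exact hroot

/-- Lemma 2.12(iii): if `rank A < rank B`, then the set of `λ : ℝ` with
`rank B ≤ rank (A + λ • B)` is open and dense in `ℝ`. -/
theorem isOpen_dense_rank_add_smul (l k : ℕ) (A B : Matrix (Fin l) (Fin k) ℝ)
    (h : A.rank < B.rank) :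
    IsOpen {lam : ℝ | B.rank ≤ (A + lam • B).rank} ∧
      Dense {lam : ℝ | B.rank ≤ (A + lam • B).rank} := by
  refine ⟨(Matrix.isOpen_setOfPred_le_rank B.rank).preimage
    (f := fun lam : ℝ => A + lam • B) (by fun_prop), ?_⟩
  convert (Matrix.finite_setOfPred_rank_add_smul_lt A B).countable.dense_compl ℝ using 1
  ext lam
  simp
end

section
/- Let A and B be real l×k matrices with Matrix.rank A < Matrix.rank B. Then the set {λ : ℝ | Matrix.rank (A + λ • B) < Matrix.rank B} is finite. (This is the sharper form of Lemma 2.12(iii) established in its proof: the complement of Λ is a proper algebraic subset of ℝ, hence finite.) -/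
/-- A matrix of rank `r` over a field compresses to the `r × r` identity matrix. -/
lemma Matrix.exists_mul_mul_eq_one_of_rank {K m n : Type*} [Field K] [Fintype m] [DecidableEq m]
    [Fintype n] [DecidableEq n] (B : Matrix m n K) :
    ∃ (P : Matrix (Fin B.rank) m K) (Q : Matrix n (Fin B.rank) K), P * B * Q = 1 := by
  let f := Matrix.toLin' B
  have hf : Module.finrank K (LinearMap.range f) = B.rank := rfl
  let e : LinearMap.range f ≃ₗ[K] (Fin B.rank → K) := LinearEquiv.ofFinrankEq _ _ (by simp [hf])
  obtain ⟨s, hs⟩ := f.rangeRestrict.exists_rightInverse_of_surjective f.range_rangeRestrict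
  obtain ⟨g, hg⟩ := (LinearMap.range f).subtype.exists_leftInverse_of_injective
    (Submodule.ker_subtype _)
  refine ⟨LinearMap.toMatrix' (e.toLinearMap ∘ₗ g),
    LinearMap.toMatrix' (s ∘ₗ e.symm.toLinearMap), Matrix.toLin'.injective ?_⟩
  refine LinearMap.ext fun x => ?_
  have h₁ : f (s (e.symm x)) = (LinearMap.range f).subtype (e.symm x) :=
    congrArg Subtype.val (LinearMap.congr_fun hs (e.symm x))
  have h₂ : g ((LinearMap.range f).subtype (e.symm x)) = e.symm x :=
    LinearMap.congr_fun hg (e.symm x)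
  simp only [Matrix.toLin'_mul, Matrix.toLin'_toMatrix', LinearMap.comp_apply, Matrix.toLin'_one,
    LinearMap.id_apply]
  change e (g (f (s (e.symm x)))) = x
  rw [h₁, h₂, e.apply_symm_apply]

/-- Sharper form of Lemma 2.12(iii): if `rank A < rank B`, then the set of
`λ : ℝ` with `rank (A + λ • B) < rank B` is finite. -/
theorem finite_rank_add_smul_lt (l k : ℕ) (A B : Matrix (Fin l) (Fin k) ℝ)
    (h : A.rank < B.rank) :
    {lam : ℝ | (A + lam • B).rank < B.rank}.Finite := by
  obtain ⟨P, Q, hPQ⟩ := B.exists_mul_mul_eq_one_of_rank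
  refine (Polynomial.finite_setOfPred_isRoot (-(P * A * Q)).charpoly_monic.ne_zero).subset
    fun lam hlam => ?_
  by_contra hroot
  have hcomp : P * (A + lam • B) * Q = Matrix.scalar _ lam - -(P * A * Q) := by
    rw [Matrix.mul_add, Matrix.add_mul, Matrix.mul_smul, Matrix.smul_mul, hPQ,
      Matrix.smul_one_eq_diagonal, Matrix.scalar_apply, sub_neg_eq_add, add_comm]
  have hdet : (P * (A + lam • B) * Q).det ≠ 0 := by
    rwa [hcomp, ← Matrix.eval_charpoly]
  have hrank := Matrix.rank_of_det_ne_zero hdet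
  rw [Fintype.card_fin] at hrank
  exact (hlam.trans_le (hrank.symm.le.trans
    ((Matrix.rank_mul_le_left _ _).trans (Matrix.rank_mul_le_right _ _)))).false
end

section
/- Let A and B be real l×k matrices with Matrix.rank A < Matrix.rank B. Then there exists ε > 0 such that for every μ : ℝ with |μ| < ε one has Matrix.rank A < Matrix.rank (B + μ • A). (This is the perturbation step used in the proof of Lemma 2.12(iii): rank(B + μA) > rank A for μ small enough.) -/
/-- Lower semicontinuity of the matrix rank. -/
theorem Matrix.isOpen_setOfPred_nat_le_rank {m n : Type*} [Fintype m] [Fintype n] (r : ℕ) :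
    IsOpen {M : Matrix m n ℝ | r ≤ M.rank} := by
  classical
  let φ : Matrix m n ℝ →ₗ[ℝ] (n → ℝ) →L[ℝ] (m → ℝ) :=
    LinearMap.toContinuousLinearMap.toLinearMap ∘ₗ (Matrix.toLin').toLinearMap
  have hφ : Continuous φ := φ.continuous_of_finiteDimensional
  convert (_root_.isOpen_setOfPred_nat_le_rank (𝕜 := ℝ) (E := n → ℝ) (F := m → ℝ) r).preimage hφ using 1
  ext M
  change r ≤ M.rank ↔ (r : Cardinal) ≤ (M.toLin').rank
  rw [LinearMap.rank, ← Module.finrank_eq_rank, Nat.cast_le]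
  rfl

/-- If `rank A < rank B`, then `rank A < rank (B + μ • A)` for all `μ` small
enough (perturbation step in the proof of Lemma 2.12(iii)). -/
theorem rank_lt_rank_add_smul_small (l k : ℕ) (A B : Matrix (Fin l) (Fin k) ℝ)
    (h : A.rank < B.rank) :
    ∃ ε > 0, ∀ μ : ℝ, |μ| < ε → A.rank < (B + μ • A).rank := by
  have hopen : IsOpen {μ : ℝ | A.rank + 1 ≤ (B + μ • A).rank} :=
    (Matrix.isOpen_setOfPred_nat_le_rank (A.rank + 1)).preimage
      (f := fun μ : ℝ => B + μ • A) (by fun_prop)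
  obtain ⟨ε, hε, hball⟩ := Metric.isOpen_iff.mp hopen 0 (by simpa using h)
  exact ⟨ε, hε, fun μ hμ => hball (by simpa using hμ)⟩
end

section
/- (Linear-algebra core of Claim 5.5.) Let A, B, C, D : ℝ satisfy A*C*D - B*(C^2 + D^2) ≠ 0, and let M : Matrix (Fin 4) (Fin 4) ℝ be the matrix whose columns are the vectors (-C, D, 0, 0), (2*D, -2*C, 0, 0), (-A, -2*B, -2*C, -D) and (2*B, A, -2*D, -C), i.e. M = !![-C, 2*D, -A, 2*B; D, -2*C, -2*B, A; 0, 0, -2*C, -2*D; 0, 0, -D, -C]. Then: (i) if C^2 ≠ D^2, then Matrix.rank M = 4; (ii) if C^2 = D^2 and A^2 ≠ 4*B^2, then Matrix.rank M = 3; (iii) if C^2 = D^2 and A^2 = 4*B^2, then Matrix.rank M = 2. -/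
namespace Matrix

/-- A nonzero minor of size `k` bounds the rank from below by `k`. -/
lemma le_rank_of_det_submatrix_ne_zero {m n R : Type*} [Fintype m] [Fintype n] [Field R]
    {k : ℕ} (M : Matrix m n R) (r : Fin k → m) (c : Fin k → n)
    (h : (M.submatrix r c).det ≠ 0) : k ≤ M.rank := by
  simpa [rank_of_det_ne_zero h] using rank_submatrix_le M r c

/-- A matrix factoring through `R ^ k` has rank at most `k`. -/
lemma rank_mul_le_inner {m n R : Type*} [Fintype m] [Fintype n] [Field R]
    {k : ℕ} (P : Matrix m (Fin k) R) (Q : Matrix (Fin k) n R) : (P * Q).rank ≤ k :=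
  (rank_mul_le_left P Q).trans (by simpa using rank_le_card_width P)

end Matrix

/-- Linear-algebra core of Claim 5.5: the rank of the matrix of the Lefschetz
map `L_{[ω]} : H²(M) → H⁴(M)` for the nilmanifold of type
`(0,0,12,13,23,14-25)`. -/
theorem rank_lefschetz_matrix_case1 (A B C D : ℝ)
    (h : A * C * D - B * (C ^ 2 + D ^ 2) ≠ 0)
    (M : Matrix (Fin 4) (Fin 4) ℝ)
    (hM : M = !![-C, 2*D, -A, 2*B; D, -2*C, -2*B, A; 0, 0, -2*C, -2*D; 0, 0, -D, -C]) :
    (C ^ 2 ≠ D ^ 2 → M.rank = 4) ∧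
      (C ^ 2 = D ^ 2 → A ^ 2 ≠ 4 * B ^ 2 → M.rank = 3) ∧
      (C ^ 2 = D ^ 2 → A ^ 2 = 4 * B ^ 2 → M.rank = 2) := by
  refine ⟨fun hCD => ?_, fun hCD hAB => ?_, fun hCD hAB => ?_⟩
  · have hdet : M.det = 4 * (C ^ 2 - D ^ 2) ^ 2 := by
      subst hM
      simp [Matrix.det_succ_row_zero, Fin.sum_univ_succ, Fin.succAbove]
      ring
    have hne : M.det ≠ 0 := by
      rw [hdet]
      exact mul_ne_zero four_ne_zero (pow_ne_zero 2 (sub_ne_zero.mpr hCD))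
    simpa using Matrix.rank_of_det_ne_zero hne
  all_goals
    obtain ⟨s, hs, rfl⟩ : ∃ s : ℝ, s ^ 2 = 1 ∧ D = s * C := by
      rcases sq_eq_sq_iff_eq_or_eq_neg.mp hCD with rfl | rfl
      · exact ⟨1, by norm_num, by ring⟩
      · exact ⟨-1, by norm_num, by ring⟩
    have hC : C ≠ 0 := by
      rintro rfl
      simp at h
  · apply le_antisymm
    · have hfac : M = !![1, 0, 0; 0, 1, 0; 0, 0, 1; 0, 0, s / 2] *
          !![-C, 2*(s*C), -A, 2*B; s*C, -2*C, -2*B, A; 0, 0, -2*C, -2*(s*C)] := by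
        subst hM
        ext i j
        fin_cases i <;> fin_cases j <;> simp [Matrix.mul_apply, Fin.sum_univ_succ] <;> grind
      rw [hfac]
      exact Matrix.rank_mul_le_inner _ _
    · apply Matrix.le_rank_of_det_submatrix_ne_zero M ![0, 1, 2] ![0, 2, 3]
      have hdet : (M.submatrix ![0, 1, 2] ![0, 2, 3]).det = -4 * C ^ 2 * (A + 2 * s * B) := by
        subst hM
        rw [Matrix.det_fin_three]
        simp
        grind
      rw [hdet]
      have hA : A + 2 * s * B ≠ 0 := by
        intro h0
        apply hAB
        grind
      positivity
  · have hA : A = -2 * s * B := by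
      have hfac : (A - 2 * s * B) * (A + 2 * s * B) = 0 := by grind
      rcases mul_eq_zero.mp hfac with h0 | h0
      · exact absurd (by grind) h
      · linarith
    apply le_antisymm
    · have hfac : M = !![1, 0; -s, 0; 0, 1; 0, s / 2] *
          !![-C, 2*(s*C), -A, 2*B; 0, 0, -2*C, -2*(s*C)] := by
        subst hM
        ext i j
        fin_cases i <;> fin_cases j <;> simp [Matrix.mul_apply, Fin.sum_univ_succ] <;> grind
      rw [hfac]
      exact Matrix.rank_mul_le_inner _ _
    · apply Matrix.le_rank_of_det_submatrix_ne_zero M ![0, 2] ![0, 2]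
      have hdet : (M.submatrix ![0, 2] ![0, 2]).det = 2 * C ^ 2 := by
        subst hM
        rw [Matrix.det_fin_two]
        simp
        ring
      rw [hdet]
      positivity
end
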